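/- arXiv:1907.10400 — 7 statements merged into one kernel-verified Lean document; each statement's English description precedes it below -/
import Mathlib

section
/- A set I ⊆ M is a Dedekind ideal — that is, an order ideal such that for every f ∈ M the set I ∩ {g ∈ M : g ≤ f} has a greatest element — if and only if I is the range P[M] of some order projection P : M → M. -/
/-- A positively ordered (p.o.) monoid. -/
class POMonoid (M : Type*) extends CommMonoid M, PartialOrder M, OrderBot M where
  le_one : ∀ f : M, f ≤ 1
  mul_le_mul_of_le : ∀ {f g : M}, f ≤ g → ∀ h : M, f * h ≤ g * h

/-- An order ideal: downward closed set. -/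
def IsOrderIdeal {M : Type*} [POMonoid M] (I : Set M) : Prop :=
  ∀ f ∈ I, ∀ g : M, g ≤ f → g ∈ I

/-- An order projection: a monotone, contractive map `P` such that
`g ≤ P f` implies `g = P g`. -/
def IsOrderProjection {M : Type*} [POMonoid M] (P : M → M) : Prop :=
  Monotone P ∧ (∀ f : M, P f ≤ f) ∧ ∀ f g : M, g ≤ P f → g = P g

/-- `I` is a Dedekind ideal iff it is the range of an order projection. -/
theorem stmt1 {M : Type*} [POMonoid M] (I : Set M) :
    (IsOrderIdeal I ∧
        ∀ f : M, ∃ m : M, m ∈ I ∧ m ≤ f ∧ ∀ g ∈ I, g ≤ f → g ≤ m)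
      ↔ ∃ P : M → M, IsOrderProjection P ∧ Set.range P = I := by
  constructor
  · rintro ⟨hI, h⟩
    choose P hPI hPle hPmax using h
    have fix : ∀ g ∈ I, g = P g := fun g hg =>
      le_antisymm (hPmax g g hg le_rfl) (hPle g)
    refine ⟨P, ⟨fun a b hab => hPmax b _ (hPI a) ((hPle a).trans hab), hPle,
      fun f g hg => fix g (hI _ (hPI f) g hg)⟩, ?_⟩
    ext g
    constructor
    · rintro ⟨f, rfl⟩
      exact hPI f
    · exact fun hg => ⟨g, (fix g hg).symm⟩
  · rintro ⟨P, ⟨hmono, hle, hfix⟩, rfl⟩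
    refine ⟨?_, fun f => ⟨P f, ⟨f, rfl⟩, hle f, ?_⟩⟩
    · rintro _ ⟨f, rfl⟩ g hg
      exact ⟨g, (hfix f g hg).symm⟩
    · rintro _ ⟨g, rfl⟩ hg
      rw [hfix g (P g) le_rfl]
      exact hmono hg
end

section
/- Every order projection on the positively ordered monoid M is a monoid projection. Moreover, every monoid projection on M is an order projection if and only if M is idempotent, i.e. f·f = f for all f ∈ M. -/
/-- A monoid projection: monotone, contractive, and `f * Q g ≤ Q (f * g)`. -/
def IsMonoidProjection {M : Type*} [POMonoid M] (Q : M → M) : Prop :=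
  Monotone Q ∧ (∀ f : M, Q f ≤ f) ∧ ∀ f g : M, f * Q g ≤ Q (f * g)

namespace POMonoid

variable {M : Type*} [POMonoid M]

theorem mul_le_right (f g : M) : f * g ≤ g := by
  simpa using mul_le_mul_of_le (le_one f) g

theorem mul_le_left (f g : M) : f * g ≤ f := by
  simpa [mul_comm] using mul_le_right g f

theorem mul_le_mul_of_le_left {f g : M} (hfg : f ≤ g) (h : M) : h * f ≤ h * g := by
  simpa [mul_comm] using mul_le_mul_of_le hfg h

theorem isMonoidProjection_mul_left (h : M) : IsMonoidProjection (fun f : M => h * f) :=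
  ⟨fun _ _ hfg => mul_le_mul_of_le_left hfg h, fun f => mul_le_right h f,
    fun f g => (mul_left_comm f h g).le⟩

end POMonoid

open POMonoid

theorem IsOrderProjection.isMonoidProjection {M : Type*} [POMonoid M] {P : M → M}
    (hP : IsOrderProjection P) : IsMonoidProjection P := by
  obtain ⟨hmono, hle, hfix⟩ := hP
  refine ⟨hmono, hle, fun f g => ?_⟩
  rw [hfix g (f * P g) (mul_le_right f (P g))]
  exact hmono (mul_le_mul_of_le_left (hle g) f)

theorem IsMonoidProjection.isOrderProjection {M : Type*} [POMonoid M] {Q : M → M}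
    (hQ : IsMonoidProjection Q) (hM : ∀ f : M, f * f = f) : IsOrderProjection Q := by
  obtain ⟨hmono, hle, hmul⟩ := hQ
  refine ⟨hmono, hle, fun f g hg => le_antisymm ?_ (hle g)⟩
  calc g = g * g := (hM g).symm
    _ ≤ g * Q f := mul_le_mul_of_le_left hg g
    _ ≤ Q (g * f) := hmul g f
    _ ≤ Q g := hmono (mul_le_left g f)

/-- Every order projection is a monoid projection, and conversely every monoid
projection is an order projection iff the p.o. monoid is idempotent. -/
theorem stmt2 {M : Type*} [POMonoid M] :
    (∀ P : M → M, IsOrderProjection P → IsMonoidProjection P) ∧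
      ((∀ Q : M → M, IsMonoidProjection Q → IsOrderProjection Q) ↔
        ∀ f : M, f * f = f) := by
  refine ⟨fun P hP => hP.isMonoidProjection, fun h f => ?_,
    fun hM Q hQ => hQ.isOrderProjection hM⟩
  have hfix := (h _ (isMonoidProjection_mul_left f)).2.2 1 f
  exact (hfix (mul_one f).ge).symm
end

section
/- Call an order ideal I of M prime if f·g ∈ I implies f ∈ I or g ∈ I. Let τ_p be the smallest topology on M containing the complement of every order prime ideal. Then multiplication M × M → M is τ_p-continuous (so (M, τ_p) is a topological monoid), and every monoid projection Q : M → M is τ_p-continuous. In particular, for every order prime ideal I and every monoid projection Q, the preimage Q⁻¹(I) is again an order prime ideal. -/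
/-- A prime set: `f * g ∈ I` implies `f ∈ I` or `g ∈ I`. -/
def IsPrimeSet {M : Type*} [POMonoid M] (I : Set M) : Prop :=
  ∀ f g : M, f * g ∈ I → f ∈ I ∨ g ∈ I

/-- The topology `τ_p` generated by the complements of order prime ideals. -/
def tauP (M : Type*) [POMonoid M] : TopologicalSpace M :=
  TopologicalSpace.generateFrom
    {s : Set M | ∃ I : Set M, IsOrderIdeal I ∧ IsPrimeSet I ∧ s = Iᶜ}

theorem IsOrderIdeal.mul_mem_iff {M : Type*} [POMonoid M] {I : Set M} (hI : IsOrderIdeal I)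
    (hp : IsPrimeSet I) (f g : M) : f * g ∈ I ↔ f ∈ I ∨ g ∈ I := by
  have mul_le_right (f g : M) : f * g ≤ g := by
    simpa using POMonoid.mul_le_mul_of_le (POMonoid.le_one f) g
  refine ⟨hp f g, ?_⟩
  rintro (h | h)
  · exact hI f h _ (mul_comm f g ▸ mul_le_right g f)
  · exact hI g h _ (mul_le_right f g)

theorem IsMonoidProjection.isOrderIdeal_preimage {M : Type*} [POMonoid M] {Q : M → M}
    (hQ : IsMonoidProjection Q) {I : Set M} (hI : IsOrderIdeal I) : IsOrderIdeal (Q ⁻¹' I) :=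
  fun f hf _ hg => hI (Q f) hf _ (hQ.1 hg)

theorem IsMonoidProjection.isPrimeSet_preimage {M : Type*} [POMonoid M] {Q : M → M}
    (hQ : IsMonoidProjection Q) {I : Set M} (hI : IsOrderIdeal I) (hp : IsPrimeSet I) :
    IsPrimeSet (Q ⁻¹' I) := fun f g hfg =>
  hp (Q f) (Q g) (hI _ hfg _
    ((POMonoid.mul_le_mul_of_le (hQ.2.1 f) (Q g)).trans (hQ.2.2 f g)))

open scoped Topology in
theorem isOpen_tauP_compl {M : Type*} [POMonoid M] {I : Set M} (hI : IsOrderIdeal I)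
    (hp : IsPrimeSet I) : IsOpen[tauP M] Iᶜ :=
  TopologicalSpace.isOpen_generateFrom_of_mem ⟨I, hI, hp, rfl⟩

theorem stmt3 {M : Type*} [POMonoid M] :
    letI : TopologicalSpace M := tauP M
    Continuous (fun p : M × M => p.1 * p.2) ∧
      (∀ Q : M → M, IsMonoidProjection Q → Continuous Q) ∧
      (∀ Q : M → M, IsMonoidProjection Q → ∀ I : Set M,
        IsOrderIdeal I → IsPrimeSet I →
          IsOrderIdeal (Q ⁻¹' I) ∧ IsPrimeSet (Q ⁻¹' I)) := by
  let _ : TopologicalSpace M := tauP M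
  refine ⟨continuous_generateFrom_iff.2 ?_, fun Q hQ => continuous_generateFrom_iff.2 ?_,
    fun Q hQ I hI hp => ⟨hQ.isOrderIdeal_preimage hI, hQ.isPrimeSet_preimage hI hp⟩⟩
  · rintro _ ⟨I, hI, hp, rfl⟩
    have h : (fun p : M × M => p.1 * p.2) ⁻¹' Iᶜ = Iᶜ ×ˢ Iᶜ := by
      ext p
      simp [hI.mul_mem_iff hp]
    rw [h]
    exact IsOpen.prod (isOpen_tauP_compl hI hp) (isOpen_tauP_compl hI hp)
  · rintro _ ⟨I, hI, hp, rfl⟩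
    exact isOpen_tauP_compl (hQ.isOrderIdeal_preimage hI) (hQ.isPrimeSet_preimage hI hp)
end

section
/- Let κ be an infinite regular cardinal and let {I_α}_{α ∈ A} be a family of order κ-ideals of the positively ordered monoid M with card A < κ. Then the intersection ⋂_{α ∈ A} I_α is a κ-ideal: every mutually (⋂_{α ∈ A} I_α)-disjoint subset of M has cardinality strictly less than κ. -/
open Cardinal

universe u

/-- `D` is mutually `I`-disjoint. -/
def MutuallyDisjointMod {M : Type*} [POMonoid M] (I D : Set M) : Prop :=
  D ∩ I = ∅ ∧ ∀ f ∈ D, ∀ g ∈ D, f ≠ g → f * g ∈ I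

/-- An intersection of fewer than `κ` order `κ`-ideals (`κ` infinite regular)
is again a `κ`-ideal. -/
theorem stmt5 {M : Type u} [POMonoid M] (κ : Cardinal.{u}) (hκ : κ.IsRegular)
    {A : Type u} (I : A → Set M) (hcard : #A < κ)
    (hord : ∀ α : A, IsOrderIdeal (I α))
    (hk : ∀ α : A, ∀ D : Set M, MutuallyDisjointMod (I α) D → #D < κ) :
    ∀ D : Set M, MutuallyDisjointMod (⋂ α : A, I α) D → #D < κ := by
  rintro D ⟨hD, hmul⟩
  have hsub : D ⊆ ⋃ α : A, D \ I α := by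
    intro f hf
    have hnot : f ∉ ⋂ α : A, I α := fun h => (hD.subset ⟨hf, h⟩).elim
    simp only [Set.mem_iInter, not_forall] at hnot
    obtain ⟨α, hα⟩ := hnot
    exact Set.mem_iUnion.2 ⟨α, hf, hα⟩
  refine (mk_le_mk_of_subset hsub).trans_lt
    ((card_iUnion_lt_iff_forall_of_isRegular hκ hcard).2 fun α => hk α _ ⟨?_, ?_⟩)
  · exact Set.sdiff_inter_self
  · exact fun f hf g hg hfg => Set.mem_iInter.1 (hmul f hf.1 g hg.1 hfg) α
end

section
/- Let I₁, …, I_N be finitely many order ℵ₀-ideals of the positively ordered monoid M, i.e. order ideals such that every mutually I_j-disjoint subset of M is finite. Then the union I₁ ∪ … ∪ I_N is an ℵ₀-ideal: every mutually (I₁ ∪ … ∪ I_N)-disjoint subset of M is finite. -/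
open Filter in
/-- Infinite Ramsey theorem for pairs, for a finite family of symmetric relations. -/
theorem Set.Infinite.exists_infinite_subset_pairwise {α ι : Type*} [Finite ι] {D : Set α}
    (hD : D.Infinite) (r : ι → α → α → Prop) (hsymm : ∀ i x y, r i x y → r i y x)
    (hr : D.Pairwise fun x y => ∃ i, r i x y) :
    ∃ i, ∃ E ⊆ D, E.Infinite ∧ E.Pairwise (r i) := by
  have : (cofinite ⊓ 𝓟 D).NeBot := hD.cofinite_inf_principal_neBot
  obtain ⟨U, hU⟩ := Ultrafilter.exists_le (cofinite ⊓ 𝓟 D)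
  have hUD : ∀ᶠ x in (U : Filter α), x ∈ D := hU.trans inf_le_right (mem_principal_self D)
  have hne (x : α) : ∀ᶠ y in (U : Filter α), x ≠ y := by
    refine hU.trans inf_le_left ?_
    filter_upwards [(Set.finite_singleton x).compl_mem_cofinite] with y hy h using hy h.symm
  have hcolor : ∀ᶠ x in (U : Filter α), ∃ i, ∀ᶠ y in (U : Filter α), r i x y := by
    filter_upwards [hUD] with x hx
    rw [← Ultrafilter.eventually_exists_iff]
    filter_upwards [hUD, hne x] with y hy hxy using hr hx hy hxy
  obtain ⟨i, hi⟩ := Ultrafilter.eventually_exists_iff.1 hcolor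
  have : Std.Symm fun x y => x ≠ y ∧ r i x y := ⟨fun x y h => ⟨h.1.symm, hsymm i x y h.2⟩⟩
  obtain ⟨f, hf, hpair⟩ := exists_seq_of_forall_finset_exists'
    (fun x => x ∈ D ∧ ∀ᶠ y in (U : Filter α), r i x y) (fun x y => x ≠ y ∧ r i x y)
    (fun s hs => (((hUD.and hi).and ((eventually_all_finset s).2
      fun x hx => (hne x).and (hs x hx).2))).exists)
  have hinj : Function.Injective f := fun m n hmn => by
    by_contra h
    exact (hpair h).1 hmn
  refine ⟨i, Set.range f, Set.range_subset_iff.2 fun n => (hf n).1,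
    Set.infinite_range_of_injective hinj, ?_⟩
  rintro _ ⟨m, rfl⟩ _ ⟨n, rfl⟩ hmn
  exact (hpair fun h => hmn (congrArg f h)).2

/-- A finite union of order `ℵ₀`-ideals is an `ℵ₀`-ideal. -/
theorem stmt6 {M : Type*} [POMonoid M] (N : ℕ) (I : Fin N → Set M)
    (hord : ∀ j : Fin N, IsOrderIdeal (I j))
    (hfin : ∀ j : Fin N, ∀ D : Set M, MutuallyDisjointMod (I j) D → D.Finite) :
    ∀ D : Set M, MutuallyDisjointMod (⋃ j : Fin N, I j) D → D.Finite := by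
  rintro D ⟨hdisj, hmul⟩
  by_contra hD
  obtain ⟨j, E, hED, hE, hpair⟩ := Set.Infinite.exists_infinite_subset_pairwise hD
    (fun j x y => x * y ∈ I j) (fun j x y h => mul_comm x y ▸ h)
    (fun x hx y hy hxy => Set.mem_iUnion.1 (hmul x hx y hy hxy))
  refine hE (hfin j E ⟨?_, fun x hx y hy hxy => hpair hx hy hxy⟩)
  exact Set.subset_eq_empty (Set.inter_subset_inter hED (Set.subset_iUnion I j)) hdisj
end

section
/- Let I be a radical order ideal of the positively ordered monoid M. Then every set T ⊆ M has a subset T₀ ⊆ T with card T₀ < κ(M, I) such that for every h ∈ T: h·g ∈ I for all g ∈ T₀ if and only if h ∈ I. -/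
open Cardinal

/-- A radical set: `f ∈ I` whenever `f ^ n ∈ I` for some `n ≥ 1`. -/
def IsRadicalSet {M : Type*} [POMonoid M] (I : Set M) : Prop :=
  ∀ f : M, ∀ n : ℕ, 1 ≤ n → f ^ n ∈ I → f ∈ I

/-- `κ(T, I)`. -/
noncomputable def kappa {M : Type*} [POMonoid M] (T I : Set M) : Cardinal :=
  sInf {c : Cardinal | ∀ D : Set M, D ⊆ T → MutuallyDisjointMod I D → #D < c}

/-- Every set contains a maximal mutually `I`-disjoint subset. -/
theorem exists_maximal_mutuallyDisjointMod {M : Type*} [POMonoid M] (I T : Set M) :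
    ∃ D : Set M, Maximal (fun D => D ⊆ T ∧ MutuallyDisjointMod I D) D := by
  refine zorn_subset {D : Set M | D ⊆ T ∧ MutuallyDisjointMod I D} fun c hc hchain =>
    ⟨⋃₀ c, ⟨Set.sUnion_subset fun D hD => (hc hD).1, ?_, ?_⟩,
      fun D hD => Set.subset_sUnion_of_mem hD⟩
  · refine Set.eq_empty_of_forall_notMem ?_
    rintro f ⟨⟨D, hD, hfD⟩, hfI⟩
    exact Set.notMem_empty f ((hc hD).2.1 ▸ ⟨hfD, hfI⟩)
  · rintro f ⟨D, hD, hfD⟩ g ⟨E, hE, hgE⟩ hne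
    rcases hchain.total hD hE with h | h
    · exact (hc hE).2.2 f (h hfD) g hgE hne
    · exact (hc hD).2.2 f hfD g (h hgE) hne

/-- The defining set of `kappa T I` is nonempty, so its infimum satisfies the defining bound. -/
theorem mk_lt_kappa {M : Type*} [POMonoid M] {I T D : Set M} (hDT : D ⊆ T)
    (hD : MutuallyDisjointMod I D) : #D < kappa T I :=
  csInf_mem (s := {c : Cardinal | ∀ D : Set M, D ⊆ T → MutuallyDisjointMod I D → #D < c})
    ⟨Order.succ #M, fun D _ _ => Order.lt_succ_of_le (mk_set_le D)⟩ D hDT hD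

/-- An order ideal absorbs multiplication. -/
theorem IsOrderIdeal.mul_mem {M : Type*} [POMonoid M] {I : Set M} (hI : IsOrderIdeal I)
    {f : M} (hf : f ∈ I) (g : M) : f * g ∈ I := by
  refine hI f hf _ ?_
  simpa [mul_comm] using POMonoid.mul_le_mul_of_le (POMonoid.le_one g) f

/-- Every `T ⊆ M` has a subset `T₀` of cardinality `< κ(M, I)` such that for
`h ∈ T`, `h` multiplies every element of `T₀` into `I` iff `h ∈ I`. -/
theorem stmt8 {M : Type*} [POMonoid M] (I : Set M)
    (hord : IsOrderIdeal I) (hrad : IsRadicalSet I) (T : Set M) :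
    ∃ T₀ : Set M, T₀ ⊆ T ∧ #T₀ < kappa Set.univ I ∧
      ∀ h ∈ T, ((∀ g ∈ T₀, h * g ∈ I) ↔ h ∈ I) := by
  obtain ⟨D, hD⟩ := exists_maximal_mutuallyDisjointMod I T
  obtain ⟨hDT, hDI, hDmul⟩ := hD.prop
  refine ⟨D, hDT, mk_lt_kappa (Set.subset_univ D) ⟨hDI, hDmul⟩, fun h hT =>
    ⟨fun hmul => ?_, fun hI g _ => hord.mul_mem hI g⟩⟩
  by_contra hI
  have hins : insert h D ⊆ T ∧ MutuallyDisjointMod I (insert h D) := by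
    refine ⟨Set.insert_subset hT hDT, ?_, ?_⟩
    · rw [Set.insert_inter_of_notMem hI, hDI]
    · rintro f (rfl | hf) g (rfl | hg) hne
      · exact absurd rfl hne
      · exact hmul g hg
      · exact mul_comm g f ▸ hmul f hf
      · exact hDmul f hf g hg hne
  have hhD : h ∈ D := hD.le_of_ge hins (Set.subset_insert h D) (Set.mem_insert h D)
  exact hI (hrad h 2 one_le_two (pow_two h ▸ hmul h hhD))
end

section
/- Let I be a radical order ℵ₀-ideal of the positively ordered monoid M (an order ideal such that every mutually I-disjoint subset of M is finite), and let Q be a nonempty set of monoid projections on M that is closed under composition. Let T ⊆ M be such that for every f ∈ T there exists Q ∈ Q with Q(f) ∈ I. Then there exists a single Q ∈ Q with Q(f) ∈ I for all f ∈ T. -/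
/-- If each element of `T` is projected into the radical order `ℵ₀`-ideal `I`
by some member of the composition-closed nonempty family `𝒬` of monoid
projections, then a single member of `𝒬` projects all of `T` into `I`. -/
theorem stmt10 {M : Type*} [POMonoid M] (I : Set M)
    (hord : IsOrderIdeal I) (hrad : IsRadicalSet I)
    (hfin : ∀ D : Set M, MutuallyDisjointMod I D → D.Finite)
    (𝒬 : Set (M → M)) (h𝒬ne : 𝒬.Nonempty)
    (h𝒬 : ∀ Q ∈ 𝒬, IsMonoidProjection Q)
    (hcomp : ∀ Q₁ ∈ 𝒬, ∀ Q₂ ∈ 𝒬, Q₁ ∘ Q₂ ∈ 𝒬)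
    (T : Set M) (hT : ∀ f ∈ T, ∃ Q ∈ 𝒬, Q f ∈ I) :
    ∃ Q ∈ 𝒬, ∀ f ∈ T, Q f ∈ I := by
  by_contra! hne
  choose t htT htI using hne
  choose R hR𝒬 hRI using hT
  let next : 𝒬 → 𝒬 := fun Q ↦
    ⟨Q.1 ∘ R (t Q.1 Q.2) (htT Q.1 Q.2), hcomp _ Q.2 _ (hR𝒬 _ _)⟩
  obtain ⟨Q₀, hQ₀⟩ := h𝒬ne
  let P : ℕ → 𝒬 := fun n ↦ next^[n] ⟨Q₀, hQ₀⟩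
  have hP (n : ℕ) : P (n + 1) = next (P n) := Function.iterate_succ_apply' _ _ _
  let f : ℕ → M := fun n ↦ t (P n).1 (P n).2
  have hanti : Antitone fun n ↦ (P n).1 := by
    refine antitone_nat_of_succ_le fun n g ↦ ?_
    rw [hP]
    exact (h𝒬 _ (P n).2).1 ((h𝒬 _ (hR𝒬 _ _)).2.1 g)
  have hmem {m n : ℕ} (hmn : m < n) : (P n).1 (f m) ∈ I := by
    have hsucc : (P (m + 1)).1 (f m) ∈ I := by
      rw [hP]
      exact hord _ (hRI (f m) (htT _ _)) _ ((h𝒬 _ (P m).2).2.1 _)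
    exact hord _ hsucc _ (hanti hmn (f m))
  let h : ℕ → M := fun n ↦ (P n).1 (f n)
  have hhI (n : ℕ) : h n ∉ I := htI _ _
  have hlt {m n : ℕ} (hmn : m < n) : h m * h n ∈ I := by
    refine hord _ (hmem hmn) _ ?_
    calc h m * h n ≤ f m * h n :=
          POMonoid.mul_le_mul_of_le ((h𝒬 _ (P m).2).2.1 (f m)) _
      _ ≤ (P n).1 (f m * f n) := (h𝒬 _ (P n).2).2.2 _ _
      _ ≤ (P n).1 (f m) := by
          refine (h𝒬 _ (P n).2).1 ?_
          rw [mul_comm]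
          simpa using POMonoid.mul_le_mul_of_le (POMonoid.le_one (f n)) (f m)
  have hmul {m n : ℕ} (hmn : m ≠ n) : h m * h n ∈ I := by
    rcases hmn.lt_or_gt with hmn | hmn
    · exact hlt hmn
    · rw [mul_comm]
      exact hlt hmn
  have hinj : Function.Injective h := by
    intro m n hmn
    by_contra hne
    refine hhI m (hrad _ 2 one_le_two ?_)
    rw [pow_two]
    nth_rewrite 2 [hmn]
    exact hmul hne
  refine Set.infinite_range_of_injective hinj (hfin _ ⟨?_, ?_⟩)
  · rw [← Set.disjoint_iff_inter_eq_empty, Set.disjoint_left]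
    rintro _ ⟨n, rfl⟩
    exact hhI n
  · rintro _ ⟨m, rfl⟩ _ ⟨n, rfl⟩ hmn
    exact hmul (ne_of_apply_ne h hmn)
end
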